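/- There is an absolute constant C with the following property. Let Θ > 0, let μ be a finite Radon measure on ℂ, and let P ⊂ P̃ be concentric closed axis-parallel squares with common center z_P and side lengths ℓ(P) ≤ ℓ(P̃). Assume that (i) μ(B(y,r)) ≤ Θ·r for every y ∈ P and every r ≥ ℓ(P), and (ii) ∫_{2P̃ ∖ P} |y − z_P|^{-1} dμ(y) ≤ Θ. Then for every nonnegative Borel function f on ℂ and every y ∈ P: ∫_{20P̃} f(x)/(|x − z_P| + ℓ(P)) dμ(x) ≤ C·Θ·M^c_μ f(y), and ∫ f(x)·ℓ(P̃)^{1/2}/(|x − z_P| + ℓ(P̃))^{3/2} dμ(x) ≤ C·Θ·M^c_μ f(y). -/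

import Mathlib

open MeasureTheory Metric
open scoped ENNReal NNReal

/-- The closed axis-parallel square with center `z` and side length `s`. -/
def csq (z : ℂ) (s : ℝ) : Set ℂ :=
  {w : ℂ | |w.re - z.re| ≤ s / 2 ∧ |w.im - z.im| ≤ s / 2}

/-- The centered maximal function `M^c_μ f (y) = sup_{r>0, μ(B(y,r))>0}
(1/μ(B(y,r))) ∫_{B(y,r)} f dμ` (with the `ℝ≥0∞` convention `0/0 = 0`). -/
noncomputable def Mc (μ : Measure ℂ) (f : ℂ → ℝ) (y : ℂ) : ℝ≥0∞ :=
  ⨆ r : {r : ℝ // 0 < r},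
    (∫⁻ x in ball y r.1, ENNReal.ofReal (f x) ∂μ) / μ (ball y r.1)

lemma ball_le_Mc (μ : Measure ℂ) [IsFiniteMeasure μ] (f : ℂ → ℝ) (y : ℂ) (r : ℝ) :
    (∫⁻ x in ball y r, ENNReal.ofReal (f x) ∂μ) ≤ Mc μ f y * μ (ball y r) := by
  by_cases h0 : μ (ball y r) = 0
  · rw [setLIntegral_measure_zero _ _ h0]; exact zero_le
  have hr : 0 < r := by
    by_contra h
    exact h0 (by rw [ball_eq_empty.2 (not_lt.1 h)]; simp)
  have h1 : (∫⁻ x in ball y r, ENNReal.ofReal (f x) ∂μ) / μ (ball y r) ≤ Mc μ f y :=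
    le_iSup (fun r : {r : ℝ // 0 < r} =>
      (∫⁻ x in ball y r.1, ENNReal.ofReal (f x) ∂μ) / μ (ball y r.1)) ⟨r, hr⟩
  exact (ENNReal.div_le_iff h0 (measure_ne_top _ _)).1 h1

lemma key_le (μ : Measure ℂ) [IsFiniteMeasure μ] (f : ℂ → ℝ) (hf : Measurable f) (y : ℂ)
    (φ : ℂ → ℝ) (hφm : Measurable φ) (hφ0 : ∀ x, 0 ≤ φ x)
    (hb : ∀ t : ℝ, 0 < t → ∃ r, {x | t < φ x} = ball y r) :
    ∫⁻ x, ENNReal.ofReal (f x) * ENNReal.ofReal (φ x) ∂μ ≤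
      Mc μ f y * ∫⁻ x, ENNReal.ofReal (φ x) ∂μ := by
  have e1 : ∫⁻ x, ENNReal.ofReal (f x) * ENNReal.ofReal (φ x) ∂μ =
      ∫⁻ x, ENNReal.ofReal (φ x) ∂(μ.withDensity fun x => ENNReal.ofReal (f x)) := by
    rw [lintegral_withDensity_eq_lintegral_mul _ hf.ennreal_ofReal hφm.ennreal_ofReal]
    rfl
  rw [e1, lintegral_eq_lintegral_meas_lt _ (Filter.Eventually.of_forall hφ0) hφm.aemeasurable,
    lintegral_eq_lintegral_meas_lt _ (Filter.Eventually.of_forall hφ0) hφm.aemeasurable]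
  have hmeas : Measurable fun t : ℝ => μ {x | t < φ x} := by
    apply Antitone.measurable
    intro s t hst
    exact measure_mono fun x hx => lt_of_le_of_lt hst hx
  rw [← lintegral_const_mul _ hmeas]
  refine setLIntegral_mono' measurableSet_Ioi fun t ht => ?_
  obtain ⟨r, hr⟩ := hb t ht
  rw [hr, withDensity_apply _ measurableSet_ball]
  exact ball_le_Mc μ f y r

lemma csq_dist {z x : ℂ} {s : ℝ} (h : x ∈ csq z s) : dist x z ≤ s := by
  obtain ⟨h1, h2⟩ := h
  rw [Complex.dist_eq]
  have := Complex.norm_le_abs_re_add_abs_im (x - z)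
  simp only [Complex.sub_re, Complex.sub_im] at this
  linarith

lemma not_csq_dist {z x : ℂ} {s : ℝ} (h : x ∉ csq z s) : s / 2 ≤ dist x z := by
  by_contra hc
  push Not at hc
  rw [Complex.dist_eq] at hc
  apply h
  have h1 := Complex.abs_re_le_norm (x - z)
  have h2 := Complex.abs_im_le_norm (x - z)
  simp only [Complex.sub_re, Complex.sub_im] at h1 h2
  exact ⟨by linarith, by linarith⟩

lemma csq_meas (z : ℂ) (s : ℝ) : MeasurableSet (csq z s) := by
  have e : csq z s = {w : ℂ | |w.re - z.re| ≤ s / 2} ∩ {w : ℂ | |w.im - z.im| ≤ s / 2} := rfl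
  have c1 : IsClosed {w : ℂ | |w.re - z.re| ≤ s / 2} :=
    isClosed_le (f := fun w : ℂ => |w.re - z.re|) (g := fun _ => s / 2) (by fun_prop) (by fun_prop)
  have c2 : IsClosed {w : ℂ | |w.im - z.im| ≤ s / 2} :=
    isClosed_le (f := fun w : ℂ => |w.im - z.im|) (g := fun _ => s / 2) (by fun_prop) (by fun_prop)
  rw [e]
  exact (c1.inter c2).measurableSet

lemma part1 (Θ : ℝ) (hΘ : 0 < Θ) (μ : Measure ℂ) [IsFiniteMeasure μ] (zP : ℂ) (a b : ℝ)
    (ha : 0 < a) (hab : a ≤ b) (y : ℂ) (hy : y ∈ csq zP a)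
    (h1 : ∀ r : ℝ, a ≤ r → μ (ball y r) ≤ ENNReal.ofReal (Θ * r))
    (h2 : (∫⁻ y in csq zP (2 * b) \ csq zP a,
            ENNReal.ofReal ((dist y zP)⁻¹) ∂μ) ≤ ENNReal.ofReal Θ) :
    ∫⁻ x in ball y (40 * b), ENNReal.ofReal ((dist x y + a)⁻¹) ∂μ ≤ ENNReal.ofReal (50 * Θ) := by
  have hyz := csq_dist hy
  have hb : 0 < b := ha.trans_le hab
  have hsub : ball y (40 * b) ⊆
      ((csq zP a) ∪ (csq zP (2 * b) \ csq zP a)) ∪ (ball y (40 * b) \ csq zP (2 * b)) := by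
    intro x hx
    by_cases c1 : x ∈ csq zP a
    · exact Or.inl (Or.inl c1)
    by_cases c2 : x ∈ csq zP (2 * b)
    · exact Or.inl (Or.inr ⟨c2, c1⟩)
    · exact Or.inr ⟨hx, c2⟩
  refine (lintegral_mono_set hsub).trans ((lintegral_union_le _ _ _).trans ?_)
  have htri : ∀ x, dist x zP ≤ dist x y + a := fun x =>
    (dist_triangle x y zP).trans (by linarith)
  have A : ∫⁻ x in csq zP a, ENNReal.ofReal ((dist x y + a)⁻¹) ∂μ ≤ ENNReal.ofReal (3 * Θ) := by
    calc _ ≤ ∫⁻ x in csq zP a, ENNReal.ofReal (a⁻¹) ∂μ := by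
          refine setLIntegral_mono measurable_const fun x _ => ENNReal.ofReal_le_ofReal ?_
          exact inv_anti₀ ha (by linarith [dist_nonneg (x := x) (y := y)])
      _ = ENNReal.ofReal (a⁻¹) * μ (csq zP a) := by rw [setLIntegral_const]
      _ ≤ ENNReal.ofReal (a⁻¹) * ENNReal.ofReal (Θ * (3 * a)) := by
          gcongr
          refine (measure_mono fun x hx => ?_).trans (h1 (3 * a) (by linarith))
          have := csq_dist hx
          have := dist_triangle_right x y zP
          rw [mem_ball]; linarith
      _ = _ := by
          rw [← ENNReal.ofReal_mul (by positivity)]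
          congr 1; field_simp
  have B : ∫⁻ x in csq zP (2 * b) \ csq zP a, ENNReal.ofReal ((dist x y + a)⁻¹) ∂μ
      ≤ ENNReal.ofReal Θ := by
    refine le_trans (setLIntegral_mono (by fun_prop) fun x hx => ENNReal.ofReal_le_ofReal ?_) h2
    have := not_csq_dist hx.2
    exact inv_anti₀ (by linarith) (htri x)
  have D : ∫⁻ x in ball y (40 * b) \ csq zP (2 * b), ENNReal.ofReal ((dist x y + a)⁻¹) ∂μ
      ≤ ENNReal.ofReal (40 * Θ) := by
    calc _ ≤ ∫⁻ x in ball y (40 * b) \ csq zP (2 * b), ENNReal.ofReal (b⁻¹) ∂μ := by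
          refine setLIntegral_mono measurable_const fun x hx => ENNReal.ofReal_le_ofReal ?_
          have := not_csq_dist hx.2
          exact inv_anti₀ hb (by linarith [htri x])
      _ = ENNReal.ofReal (b⁻¹) * μ (ball y (40 * b) \ csq zP (2 * b)) := by rw [setLIntegral_const]
      _ ≤ ENNReal.ofReal (b⁻¹) * ENNReal.ofReal (Θ * (40 * b)) := by
          gcongr
          exact (measure_mono Set.sdiff_subset).trans (h1 (40 * b) (by linarith))
      _ = _ := by
          rw [← ENNReal.ofReal_mul (by positivity)]
          congr 1; field_simp
  refine (add_le_add ((lintegral_union_le _ _ _).trans (add_le_add A B)) D).trans ?_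
  rw [← ENNReal.ofReal_add (by positivity) (by positivity),
    ← ENNReal.ofReal_add (by positivity) (by positivity)]
  exact ENNReal.ofReal_le_ofReal (by linarith)

lemma level2 (b d t : ℝ) (hb : 0 < b) (hd : 0 ≤ d) (ht : 0 < t) :
    t < Real.sqrt b / (d + b) ^ (3 / 2 : ℝ) ↔ d < (Real.sqrt b / t) ^ (2 / 3 : ℝ) - b := by
  have hs := Real.sqrt_pos.2 hb
  have hp : 0 < (d + b) ^ (3 / 2 : ℝ) := Real.rpow_pos_of_pos (by linarith) _
  rw [lt_div_comm₀ ht hp, lt_sub_iff_add_lt]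
  have e : (2 / 3 : ℝ) = (3 / 2 : ℝ)⁻¹ := by norm_num
  rw [e, Real.lt_rpow_inv_iff_of_pos (by linarith) (by positivity) (by norm_num)]

lemma part2 (Θ : ℝ) (hΘ : 0 < Θ) (μ : Measure ℂ) [IsFiniteMeasure μ] (a b : ℝ)
    (ha : 0 < a) (hab : a ≤ b) (y : ℂ)
    (h1 : ∀ r : ℝ, a ≤ r → μ (ball y r) ≤ ENNReal.ofReal (Θ * r)) :
    ∫⁻ x, ENNReal.ofReal (Real.sqrt b / (dist x y + b) ^ (3 / 2 : ℝ)) ∂μ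
      ≤ ENNReal.ofReal (3 * Θ) := by
  have hb : 0 < b := ha.trans_le hab
  have hs := Real.sqrt_pos.2 hb
  rw [lintegral_eq_lintegral_meas_lt _ (Filter.Eventually.of_forall fun x => by positivity)
    (Measurable.aemeasurable (by fun_prop))]
  have hbound : ∀ t ∈ Set.Ioi (0 : ℝ),
      μ {x | t < Real.sqrt b / (dist x y + b) ^ (3 / 2 : ℝ)} ≤
      (Set.Ioc 0 (b⁻¹)).indicator
        (fun t => ENNReal.ofReal (Θ * b ^ (1 / 3 : ℝ) * t ^ (-(2 / 3) : ℝ))) t := by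
    intro t ht
    have ht : 0 < t := ht
    have e : {x | t < Real.sqrt b / (dist x y + b) ^ (3 / 2 : ℝ)} =
        ball y ((Real.sqrt b / t) ^ (2 / 3 : ℝ) - b) := by
      ext x
      exact level2 b _ t hb dist_nonneg ht
    have e2 : (Real.sqrt b / t) ^ (2 / 3 : ℝ) = b ^ (1 / 3 : ℝ) * t ^ (-(2 / 3) : ℝ) := by
      rw [Real.div_rpow hs.le ht.le, Real.rpow_neg ht.le, Real.sqrt_eq_rpow, ← Real.rpow_mul hb.le]
      norm_num [div_eq_mul_inv]
    rw [e]
    by_cases hc : (Real.sqrt b / t) ^ (2 / 3 : ℝ) ≤ b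
    · rw [ball_eq_empty.2 (by linarith)]; simp
    push Not at hc
    have htb : t ≤ b⁻¹ := by
      have := (level2 b 0 t hb le_rfl ht).2 (by linarith)
      rw [zero_add] at this
      have e3 : Real.sqrt b / b ^ (3 / 2 : ℝ) = b⁻¹ := by
        rw [Real.sqrt_eq_rpow, ← Real.rpow_sub hb, ← Real.rpow_neg_one]; norm_num
      rw [e3] at this
      exact this.le
    have hm : t ∈ Set.Ioc 0 (b⁻¹) := ⟨ht, htb⟩
    rw [Set.indicator_of_mem hm, mul_assoc, ← e2]
    exact (measure_mono (ball_subset_ball (by linarith))).trans (h1 _ (by linarith))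
  refine (setLIntegral_mono' measurableSet_Ioi hbound).trans ?_
  refine (setLIntegral_le_lintegral _ _).trans ?_
  rw [lintegral_indicator measurableSet_Ioc]
  have hbi : (0 : ℝ) ≤ b⁻¹ := by positivity
  have hint : IntervalIntegrable (fun t : ℝ => Θ * b ^ (1 / 3 : ℝ) * t ^ (-(2 / 3) : ℝ))
      volume 0 b⁻¹ :=
    (intervalIntegral.intervalIntegrable_rpow' (by norm_num)).const_mul _
  rw [← ofReal_integral_eq_lintegral_ofReal
    ((intervalIntegrable_iff_integrableOn_Ioc_of_le hbi).1 hint)]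
  · rw [← intervalIntegral.integral_of_le hbi, intervalIntegral.integral_const_mul,
      integral_rpow (Or.inl (by norm_num))]
    apply ENNReal.ofReal_le_ofReal
    apply le_of_eq
    have e4 : (-(2 / 3) + 1 : ℝ) = 1 / 3 := by norm_num
    rw [e4, Real.zero_rpow (by norm_num), Real.inv_rpow hb.le]
    have : 0 < b ^ (1 / 3 : ℝ) := by positivity
    field_simp
    ring
  · filter_upwards [ae_restrict_mem measurableSet_Ioc] with t ht
    have := ht.1
    positivity

theorem stmt17 :
    ∃ C : ℝ, 0 < C ∧
      ∀ Θ : ℝ, 0 < Θ →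
      ∀ μ : Measure ℂ, IsFiniteMeasure μ →
      ∀ (zP : ℂ) (ℓP ℓP' : ℝ), 0 < ℓP → ℓP ≤ ℓP' →
        (∀ y ∈ csq zP ℓP, ∀ r : ℝ, ℓP ≤ r →
          μ (ball y r) ≤ ENNReal.ofReal (Θ * r)) →
        (∫⁻ y in csq zP (2 * ℓP') \ csq zP ℓP,
            ENNReal.ofReal ((dist y zP)⁻¹) ∂μ) ≤ ENNReal.ofReal Θ →
      ∀ f : ℂ → ℝ, Measurable f → (∀ x, 0 ≤ f x) →
      ∀ y ∈ csq zP ℓP,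
        ((∫⁻ x in csq zP (20 * ℓP'),
            ENNReal.ofReal (f x / (dist x zP + ℓP)) ∂μ) ≤
          ENNReal.ofReal (C * Θ) * Mc μ f y) ∧
        ((∫⁻ x, ENNReal.ofReal
            (f x * Real.sqrt ℓP' / (dist x zP + ℓP') ^ (3 / 2 : ℝ)) ∂μ) ≤
          ENNReal.ofReal (C * Θ) * Mc μ f y) := by
  refine ⟨100, by norm_num, ?_⟩
  intro Θ hΘ μ hμ zP a b ha hab h1 h2 f hf hf0 y hy
  have hb : 0 < b := ha.trans_le hab
  have hyz := csq_dist hy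
  have htri : ∀ x, dist x y ≤ dist x zP + a := fun x =>
    (dist_triangle_right x y zP).trans (by linarith)
  constructor
  · set φ : ℂ → ℝ := (ball y (40 * b)).indicator (fun x => (dist x y + a)⁻¹) with hφ
    have hφm : Measurable φ := Measurable.indicator (by fun_prop) measurableSet_ball
    have hφ0 : ∀ x, 0 ≤ φ x := fun x => Set.indicator_nonneg (fun x _ => by positivity) x
    have hK := key_le μ f hf y φ hφm hφ0 (by
      intro t ht
      refine ⟨min (40 * b) (t⁻¹ - a), ?_⟩
      ext x
      have hd := dist_nonneg (x := x) (y := y)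
      simp only [Set.mem_ofPred_eq, mem_ball, lt_min_iff]
      by_cases hx : x ∈ ball y (40 * b)
      · rw [hφ, Set.indicator_of_mem hx, lt_inv_comm₀ ht (by linarith), lt_sub_iff_add_lt]
        exact ⟨fun h => ⟨hx, h⟩, fun h => h.2⟩
      · rw [hφ, Set.indicator_of_notMem hx]
        exact ⟨fun h => absurd h (by linarith), fun h => absurd h.1 hx⟩)
    have hI : ∫⁻ x, ENNReal.ofReal (φ x) ∂μ ≤ ENNReal.ofReal (50 * Θ) := by
      have := part1 Θ hΘ μ zP a b ha hab y hy (h1 y hy) h2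
      rw [← lintegral_indicator measurableSet_ball] at this
      refine le_trans (lintegral_mono fun x => ?_) this
      by_cases hx : x ∈ ball y (40 * b)
      · rw [hφ, Set.indicator_of_mem hx, Set.indicator_of_mem hx]
      · rw [hφ, Set.indicator_of_notMem hx]; simp
    calc _ ≤ ∫⁻ x in csq zP (20 * b),
            2 * (ENNReal.ofReal (f x) * ENNReal.ofReal (φ x)) ∂μ := by
          refine setLIntegral_mono' (csq_meas _ _) fun x hx => ?_
          have hxz := csq_dist hx
          have hd := dist_nonneg (x := x) (y := y)
          have hd' := dist_nonneg (x := x) (y := zP)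
          have hxb : x ∈ ball y (40 * b) := by rw [mem_ball]; linarith [htri x]
          rw [hφ, Set.indicator_of_mem hxb, ← ENNReal.ofReal_mul (hf0 x),
            ← ENNReal.ofReal_ofNat 2, ← ENNReal.ofReal_mul (by norm_num)]
          apply ENNReal.ofReal_le_ofReal
          have : (dist x zP + a)⁻¹ ≤ 2 * (dist x y + a)⁻¹ := by
            rw [← div_eq_mul_inv, inv_eq_one_div, div_le_div_iff₀ (by linarith) (by linarith)]
            linarith [htri x]
          calc f x / (dist x zP + a) = f x * (dist x zP + a)⁻¹ := div_eq_mul_inv _ _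
            _ ≤ f x * (2 * (dist x y + a)⁻¹) := mul_le_mul_of_nonneg_left this (hf0 x)
            _ = _ := by ring
      _ ≤ ∫⁻ x, 2 * (ENNReal.ofReal (f x) * ENNReal.ofReal (φ x)) ∂μ :=
          setLIntegral_le_lintegral _ _
      _ = 2 * ∫⁻ x, ENNReal.ofReal (f x) * ENNReal.ofReal (φ x) ∂μ :=
          lintegral_const_mul _ (hf.ennreal_ofReal.mul hφm.ennreal_ofReal)
      _ ≤ 2 * (Mc μ f y * ENNReal.ofReal (50 * Θ)) := by
          gcongr
          exact hK.trans (by gcongr)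
      _ = (2 * ENNReal.ofReal (50 * Θ)) * Mc μ f y := by ring
      _ = _ := by
          rw [← ENNReal.ofReal_ofNat 2, ← ENNReal.ofReal_mul (by norm_num)]
          congr 2; ring
  · set φ : ℂ → ℝ := fun x => Real.sqrt b / (dist x y + b) ^ (3 / 2 : ℝ) with hφ
    have hs := Real.sqrt_pos.2 hb
    have hφm : Measurable φ := by fun_prop
    have hφ0 : ∀ x, 0 ≤ φ x := fun x => by positivity
    have hK := key_le μ f hf y φ hφm hφ0 (by
      intro t ht
      refine ⟨(Real.sqrt b / t) ^ (2 / 3 : ℝ) - b, ?_⟩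
      ext x
      exact level2 b _ t hb dist_nonneg ht)
    have hI : ∫⁻ x, ENNReal.ofReal (φ x) ∂μ ≤ ENNReal.ofReal (3 * Θ) :=
      part2 Θ hΘ μ a b ha hab y (h1 y hy)
    calc _ ≤ ∫⁻ x, 4 * (ENNReal.ofReal (f x) * ENNReal.ofReal (φ x)) ∂μ := by
          refine lintegral_mono fun x => ?_
          have hd := dist_nonneg (x := x) (y := y)
          have hd' := dist_nonneg (x := x) (y := zP)
          rw [← ENNReal.ofReal_mul (hf0 x),
            ← ENNReal.ofReal_ofNat 4, ← ENNReal.ofReal_mul (by norm_num)]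
          apply ENNReal.ofReal_le_ofReal
          have hle : (dist x y + b) ^ (3 / 2 : ℝ) ≤ 4 * (dist x zP + b) ^ (3 / 2 : ℝ) := by
            calc (dist x y + b) ^ (3 / 2 : ℝ) ≤ (2 * (dist x zP + b)) ^ (3 / 2 : ℝ) :=
                  Real.rpow_le_rpow (by linarith) (by linarith [htri x]) (by norm_num)
              _ = 2 ^ (3 / 2 : ℝ) * (dist x zP + b) ^ (3 / 2 : ℝ) :=
                  Real.mul_rpow (by norm_num) (by linarith)
              _ ≤ 4 * (dist x zP + b) ^ (3 / 2 : ℝ) := by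
                  gcongr
                  calc (2 : ℝ) ^ (3 / 2 : ℝ) ≤ 2 ^ (2 : ℝ) :=
                        Real.rpow_le_rpow_of_exponent_le (by norm_num) (by norm_num)
                    _ = 4 := by norm_num
          have hp1 : 0 < (dist x y + b) ^ (3 / 2 : ℝ) := Real.rpow_pos_of_pos (by linarith) _
          have hp2 : 0 < (dist x zP + b) ^ (3 / 2 : ℝ) := Real.rpow_pos_of_pos (by linarith) _
          have hfs : 0 ≤ f x * Real.sqrt b := mul_nonneg (hf0 x) hs.le
          have e : 4 * (f x * φ x) =
              (4 * (f x * Real.sqrt b)) / (dist x y + b) ^ (3 / 2 : ℝ) := by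
            rw [hφ]; ring
          rw [e, div_le_div_iff₀ hp2 hp1]
          calc _ ≤ f x * Real.sqrt b * (4 * (dist x zP + b) ^ (3 / 2 : ℝ)) :=
                mul_le_mul_of_nonneg_left hle hfs
            _ = _ := by ring
      _ = 4 * ∫⁻ x, ENNReal.ofReal (f x) * ENNReal.ofReal (φ x) ∂μ :=
          lintegral_const_mul _ (hf.ennreal_ofReal.mul hφm.ennreal_ofReal)
      _ ≤ 4 * (Mc μ f y * ENNReal.ofReal (3 * Θ)) := by
          gcongr
          exact hK.trans (by gcongr)
      _ = (4 * ENNReal.ofReal (3 * Θ)) * Mc μ f y := by ring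
      _ ≤ _ := by
          rw [← ENNReal.ofReal_ofNat 4, ← ENNReal.ofReal_mul (by norm_num)]
          refine mul_le_mul_left (ENNReal.ofReal_le_ofReal ?_) _
          linarith
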